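/- arXiv:math/0304075 — 2 statements merged into one kernel-verified Lean document; each statement's English description precedes it below -/
import Mathlib

section
/- Suppose A is Γ-graded D-simple. Let β ∈ 𝒥 with supp(β) = {1,2,...,n}, and let ∂'₁,...,∂'ₙ ∈ Der^ε(A) be A-linearly independent homogeneous color-derivations whose degrees satisfy deg(∂'_i) − deg(d_i) = deg(∂'_j) − deg(d_j) for all i,j. If there exist nonzero scalars a₁,...,aₙ ∈ F such that x·Σ_{i=1}^n a_i ε(deg(d^{β−δ^{(i)}}), b̄) ∂'_i(b) d^{β−δ^{(i)}} ∈ W for all homogeneous x, b ∈ A (where b̄ is the degree of b), then A d^{β−δ^{(i)}} ⊆ W for each i = 1,...,n. -/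
/-- A skew-symmetric bicharacter `ε : Γ × Γ → F^×`. -/
def IsBichar {F : Type} [Field F] {Γ : Type} [AddCommGroup Γ] (ε : Γ → Γ → F) : Prop :=
  (∀ lam mu, ε lam mu * ε mu lam = 1) ∧
  (∀ lam mu nu, ε lam (mu + nu) = ε lam mu * ε lam nu)

variable (F : Type) [Field F] (Γ : Type) [AddCommGroup Γ] [DecidableEq Γ]
  (A : Type) [Ring A] [Algebra F A]

/-- left multiplication operators -/
noncomputable def mulL : A →ₗ[F] Module.End F A := (Algebra.lmul F A).toLinearMap

variable {F Γ A}

/-- `f ∈ End_F(A)` is homogeneous of degree `δ`. -/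
def IsHomogMap (𝒜 : Γ → Submodule F A) (δ : Γ) (f : Module.End F A) : Prop :=
  ∀ lam : Γ, ∀ a ∈ 𝒜 lam, f a ∈ 𝒜 (lam + δ)

/-- `f` is a homogeneous color-derivation of degree `δ`. -/
def IsColorDer (𝒜 : Γ → Submodule F A) (ε : Γ → Γ → F) (δ : Γ) (f : Module.End F A) : Prop :=
  IsHomogMap 𝒜 δ f ∧
  ∀ lam : Γ, ∀ a ∈ 𝒜 lam, ∀ b : A, f (a * b) = f a * b + ε δ lam • (a * f b)

/-- `Der^ε(A)`: the F-span of homogeneous color derivations. -/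
def DerE (𝒜 : Γ → Submodule F A) (ε : Γ → Γ → F) : Submodule F (Module.End F A) :=
  Submodule.span F {f | ∃ δ, IsColorDer 𝒜 ε δ f}

/-- `A` is ε-commutative. -/
def IsColorComm (𝒜 : Γ → Submodule F A) (ε : Γ → Γ → F) : Prop :=
  ∀ lam mu : Γ, ∀ a ∈ 𝒜 lam, ∀ b ∈ 𝒜 mu, a * b = ε lam mu • (b * a)

/-- `D` is color-commutative. -/
def DColorComm (𝒜 : Γ → Submodule F A) (ε : Γ → Γ → F) (D : Submodule F (Module.End F A)) : Prop :=
  ∀ δ δ' f g, f ∈ D → g ∈ D → IsColorDer 𝒜 ε δ f → IsColorDer 𝒜 ε δ' g →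
    f * g = ε δ δ' • (g * f)

/-- `D` is a Γ-graded subspace: it is spanned by its homogeneous color-derivations. -/
def DGraded (𝒜 : Γ → Submodule F A) (ε : Γ → Γ → F) (D : Submodule F (Module.End F A)) : Prop :=
  D = Submodule.span F {f | f ∈ D ∧ ∃ δ, IsColorDer 𝒜 ε δ f}

/-- `A[D]`: the unital subalgebra of `End_F(A)` generated by left multiplications and `D`. -/
noncomputable def AD (D : Submodule F (Module.End F A)) : Subalgebra F (Module.End F A) :=
  Algebra.adjoin F (Set.range (mulL F A) ∪ (D : Set (Module.End F A)))

/-- `A` is Γ-graded `D`-simple. -/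
def GradedDSimple (𝒜 : Γ → Submodule F A) [GradedAlgebra 𝒜] (D : Submodule F (Module.End F A)) :
    Prop :=
  ∀ I : Ideal A, Ideal.IsHomogeneous 𝒜 I → (∀ f ∈ D, ∀ x ∈ I, f x ∈ I) → I = ⊥ ∨ I = ⊤

/-- F₁ = A^D -/
def F1 (D : Submodule F (Module.End F A)) : Submodule F A where
  carrier := {u | ∀ f ∈ D, f u = 0}
  add_mem' := by
    intro a b ha hb f hf
    rw [map_add, ha f hf, hb f hf, add_zero]
  zero_mem' := by intro f hf; exact map_zero f
  smul_mem' := by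
    intro c x hx f hf
    rw [map_smul, hx f hf, smul_zero]

/-- the derived space `W = [A[D], A[D]]`. -/
def Wsub (𝒜 : Γ → Submodule F A) (ε : Γ → Γ → F) (D : Submodule F (Module.End F A)) :
    Submodule F (Module.End F A) :=
  Submodule.span F {w | ∃ γ γ' x y, x ∈ AD D ∧ y ∈ AD D ∧
    IsHomogMap 𝒜 γ x ∧ IsHomogMap 𝒜 γ' y ∧ w = x * y - ε γ γ' • (y * x)}

/-- `F₁[D]`. -/
noncomputable def F1D (D : Submodule F (Module.End F A)) : Subalgebra F (Module.End F A) :=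
  Algebra.adjoin F ((mulL F A '' (F1 D : Set A)) ∪ (D : Set (Module.End F A)))

/-- `𝒟 = Der^ε(A) ∩ F₁[D]`. -/
def DScr (𝒜 : Γ → Submodule F A) (ε : Γ → Γ → F) (D : Submodule F (Module.End F A)) :
    Set (Module.End F A) :=
  {f | f ∈ F1D D ∧ f ∈ DerE 𝒜 ε}

variable {I : Type} [LinearOrder I]

/-- ordered product `d^α`. -/
noncomputable def dpow (d : I → Module.End F A) (α : I →₀ ℕ) : Module.End F A :=
  ((α.support.sort (· ≤ ·)).map fun i => d i ^ α i).prod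

/-- membership in the index set 𝒥. -/
def inJ (ε : Γ → Γ → F) (δd : I → Γ) (α : I →₀ ℕ) : Prop :=
  (∀ i, ringChar F ≠ 0 → α i ≤ ringChar F - 1) ∧
  (∀ i, ε (δd i) (δd i) = -1 → α i ≤ 1)

/-- the degree of `d^α`. -/
def degJ (δd : I → Γ) (α : I →₀ ℕ) : Γ := α.sum fun i n => n • δd i

/-- the subalgebra `S` of `End_F(A)` is Γ-graded simple. -/
def GradedSimpleAlgOn (𝒜 : Γ → Submodule F A) (S : Subalgebra F (Module.End F A)) : Prop :=
  ∀ L : Submodule F (Module.End F A),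
    L ≤ Subalgebra.toSubmodule S →
    (∀ x ∈ S, ∀ y ∈ L, x * y ∈ L ∧ y * x ∈ L) →
    L = Submodule.span F {f | f ∈ L ∧ ∃ δ, IsHomogMap 𝒜 δ f} →
    (L = ⊥ ∨ L = Subalgebra.toSubmodule S)

/-- variant of 𝒥 without characteristic restriction -/
def inJ0 (ε : Γ → Γ → F) (δd : I → Γ) (α : I →₀ ℕ) : Prop :=
  ∀ i, ε (δd i) (δd i) = -1 → α i ≤ 1

/-- the sum `Σ_{α ∈ J0} B d^α` is direct -/
def DirectOn (d : I → Module.End F A) (J0 : Set (I →₀ ℕ)) (Bs : Set A) : Prop :=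
  ∀ (s : Finset (I →₀ ℕ)) (c : (I →₀ ℕ) → A), ↑s ⊆ J0 → (∀ α ∈ s, c α ∈ Bs) →
    (∑ α ∈ s, mulL F A (c α) * dpow d α) = 0 → ∀ α ∈ s, mulL F A (c α) * dpow d α = 0

/-- span of color brackets of homogeneous elements of `M` and `N` -/
def brkE (𝒜 : Γ → Submodule F A) (ε : Γ → Γ → F) (M N : Submodule F (Module.End F A)) :
    Submodule F (Module.End F A) :=
  Submodule.span F {w | ∃ γ γ' x y, x ∈ M ∧ y ∈ N ∧
    IsHomogMap 𝒜 γ x ∧ IsHomogMap 𝒜 γ' y ∧ w = x * y - ε γ γ' • (y * x)}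

set_option linter.unusedSectionVars false

/-- The degree `0` part of a nonzero graded family closed under multiplication by `A` and under `D`
contains `1` when `A` is graded `D`-simple. -/
theorem one_mem_of_graded_family (𝒜 : Γ → Submodule F A) [GradedAlgebra 𝒜] (ε : Γ → Γ → F)
    (D : Submodule F (Module.End F A)) (hDgr : DGraded 𝒜 ε D) (hsimple : GradedDSimple 𝒜 D)
    (K : Γ → Submodule F A) (hK : ∀ ν, K ν ≤ 𝒜 ν)
    (hmul : ∀ ρ ν, ∀ a ∈ 𝒜 ρ, ∀ x ∈ K ν, a * x ∈ K (ρ + ν))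
    (hD : ∀ f ∈ D, ∀ δ, IsColorDer 𝒜 ε δ f → ∀ ν, ∀ x ∈ K ν, f x ∈ K (ν + δ))
    (hne : ∃ ν, ∃ x ∈ K ν, x ≠ 0) : (1 : A) ∈ K 0 := by
  have hself : ∀ ν, ∀ x ∈ K ν, ∀ ν', (DirectSum.decompose 𝒜 x ν' : A) ∈ K ν' := by
    intro ν x hx ν'
    by_cases h : ν = ν'
    · subst h
      rwa [DirectSum.decompose_of_mem_same 𝒜 (hK ν hx)]
    · rw [DirectSum.decompose_of_mem_ne 𝒜 (hK ν hx) h]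
      exact zero_mem _
  let J : Ideal A :=
    { carrier := {x | ∀ ν, (DirectSum.decompose 𝒜 x ν : A) ∈ K ν}
      add_mem' := by
        intro x y hx hy ν
        rw [DirectSum.decompose_add, DirectSum.add_apply, Submodule.coe_add]
        exact add_mem (hx ν) (hy ν)
      zero_mem' := by
        intro ν
        simp
      smul_mem' := by
        intro r x hx
        induction r using DirectSum.Decomposition.inductionOn 𝒜 with
        | zero => intro ν; simp
        | @homogeneous ρ a =>
          intro ν
          obtain ⟨ν', rfl⟩ : ∃ ν', ν = ρ + ν' := ⟨ν - ρ, by abel⟩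
          rw [smul_eq_mul, DirectSum.coe_decompose_mul_add_of_left_mem 𝒜 a.2]
          exact hmul _ _ _ a.2 _ (hx ν')
        | add r s hr hs =>
          intro ν
          rw [add_smul, DirectSum.decompose_add, DirectSum.add_apply, Submodule.coe_add]
          exact add_mem (hr ν) (hs ν) }
  have hJ : ∀ x, x ∈ J ↔ ∀ ν, (DirectSum.decompose 𝒜 x ν : A) ∈ K ν := fun x => Iff.rfl
  have hJhom : J.IsHomogeneous 𝒜 := by
    intro ν x hx
    exact (hJ _).2 (hself ν _ ((hJ x).1 hx ν))
  have hJder : ∀ f ∈ D, ∀ δ, IsColorDer 𝒜 ε δ f → ∀ x ∈ J, f x ∈ J := by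
    intro f hf δ hfδ x hx
    classical
    rw [← DirectSum.sum_support_decompose 𝒜 x, map_sum]
    refine J.sum_mem fun ν _ => ?_
    exact (hJ _).2 (hself _ _ (hD f hf δ hfδ ν _ ((hJ x).1 hx ν)))
  have hJD : ∀ f ∈ D, ∀ x ∈ J, f x ∈ J := by
    intro f hf x hx
    rw [hDgr] at hf
    induction hf using Submodule.span_induction with
    | mem f hf =>
      obtain ⟨hf, δ, hfδ⟩ := hf
      exact hJder f hf δ hfδ x hx
    | zero => exact J.zero_mem
    | add f g _ _ hf hg => exact J.add_mem hf hg
    | smul c f _ hf =>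
      rw [LinearMap.smul_apply, Algebra.smul_def]
      exact J.mul_mem_left _ hf
  rcases hsimple J hJhom hJD with h | h
  · obtain ⟨ν, x, hx, hx0⟩ := hne
    have : x ∈ J := (hJ x).2 (hself ν x hx)
    rw [h] at this
    exact absurd this hx0
  · have h1 : (1 : A) ∈ J := h ▸ Submodule.mem_top
    have := (hJ 1).1 h1 0
    rwa [DirectSum.decompose_of_mem_same 𝒜 SetLike.GradedOne.one_mem] at this

/-- A graded `D`-stable `A`-submodule of the free module `A^ι` (with shifts `g`) either contains
all the standard basis vectors or is annihilated by a homogeneous vector having an entry `-1`. -/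
theorem single_mem_or_exists_annihilator (𝒜 : Γ → Submodule F A) [GradedAlgebra 𝒜]
    (ε : Γ → Γ → F) (D : Submodule F (Module.End F A)) (hDgr : DGraded 𝒜 ε D)
    (hsimple : GradedDSimple 𝒜 D) {ι : Type} [Fintype ι] [DecidableEq ι] (g : ι → Γ)
    (H : Γ → Submodule F (ι → A)) (hgr : ∀ m, ∀ y ∈ H m, ∀ i, y i ∈ 𝒜 (m - g i))
    (hmul : ∀ ρ m, ∀ a ∈ 𝒜 ρ, ∀ y ∈ H m, (fun i => a * y i) ∈ H (ρ + m))
    (hD : ∀ f ∈ D, ∀ δ, IsColorDer 𝒜 ε δ f → ∀ m, ∀ y ∈ H m, (fun i => f (y i)) ∈ H (m + δ)) :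
    (∀ i, Pi.single i 1 ∈ H (g i)) ∨
      ∃ (t : ι) (c : ι → A), c t = -1 ∧ (∀ i, c i ∈ 𝒜 (g i - g t)) ∧
        ∀ m, ∀ y ∈ H m, ∑ i, y i * c i = 0 := by
  let P : Finset ι → Prop := fun T => ∀ m, ∀ y ∈ H m, (∀ i ∉ T, y i = 0) → y = 0
  have hP0 : P ∅ := fun m y _ h => funext fun i => h i (by simp)
  obtain ⟨T, hT⟩ : ∃ T, Maximal P T := (Set.toFinite {T | P T}).exists_maximal ⟨∅, hP0⟩
  have hpivot : ∀ j ∉ T, ∃ y ∈ H (g j), y j = 1 ∧ ∀ i ∉ T, i ≠ j → y i = 0 := by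
    intro j hj
    have hnP : ¬ P (insert j T) := by
      intro h
      exact hj (hT.2 h (Finset.subset_insert j T) (Finset.mem_insert_self j T))
    let V : Submodule F (ι → A) :=
      { carrier := {y | ∀ i ∉ T, i ≠ j → y i = 0}
        add_mem' := fun {x y} hx hy i hi hij => by simp [hx i hi hij, hy i hi hij]
        zero_mem' := fun i _ _ => rfl
        smul_mem' := fun c y hy i hi hij => by simp [hy i hi hij] }
    have h1 := one_mem_of_graded_family 𝒜 ε D hDgr hsimple
      (fun ν => (H (ν + g j) ⊓ V).map (LinearMap.proj j)) ?_ ?_ ?_ ?_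
    · obtain ⟨y, ⟨hy, hyV⟩, hy1⟩ := h1
      rw [zero_add] at hy
      exact ⟨y, hy, hy1, hyV⟩
    · rintro ν _ ⟨y, ⟨hy, -⟩, rfl⟩
      simpa using hgr _ y hy j
    · rintro ρ ν a ha _ ⟨y, ⟨hy, hyV⟩, rfl⟩
      refine ⟨fun i => a * y i, ⟨?_, fun i hi hij => ?_⟩, rfl⟩
      · simpa only [add_assoc, SetLike.mem_coe] using hmul ρ _ a ha y hy
      · simp [hyV i hi hij]
    · rintro f hf δ hfδ ν _ ⟨y, ⟨hy, hyV⟩, rfl⟩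
      refine ⟨fun i => f (y i), ⟨?_, fun i hi hij => ?_⟩, rfl⟩
      · simpa only [add_right_comm, SetLike.mem_coe] using hD f hf δ hfδ _ y hy
      · simp [hyV i hi hij]
    · simp only [P, not_forall] at hnP
      obtain ⟨m, y, hy, hyT, hy0⟩ := hnP
      refine ⟨m - g j, y j, ⟨y, ⟨by simpa using hy, fun i hi hij => hyT i ?_⟩, rfl⟩, fun h => ?_⟩
      · simp [hi, hij]
      · refine hy0 (hT.1 m y hy fun i hi => ?_)
        by_cases hij : i = j
        · rw [hij, h]
        · exact hyT i (by simp [hi, hij])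
  choose! z hzH hz1 hz0 using hpivot
  have hreduce : ∀ m, ∀ y ∈ H m, ∀ i, y i = ∑ j ∈ Finset.univ \ T, y j * z j i := by
    intro m y hy i
    have h0 : (y - ∑ j ∈ Finset.univ \ T, fun i => y j * z j i) = 0 := by
      refine hT.1 m _ (sub_mem hy (Submodule.sum_mem _ fun j hj => ?_)) fun k hk => ?_
      · have := hmul _ _ _ (hgr m y hy j) (z j) (hzH j (by simpa using hj))
        rwa [sub_add_cancel] at this
      · rw [Pi.sub_apply, Finset.sum_apply, Finset.sum_eq_single k, hz1 k hk, mul_one, sub_self]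
        · intro j hj hjk
          rw [hz0 j (by simpa using hj) k hk (Ne.symm hjk), mul_zero]
        · intro h
          exact absurd (by simpa using hk) h
    have := congrFun h0 i
    rwa [Pi.sub_apply, Finset.sum_apply, Pi.zero_apply, sub_eq_zero] at this
  rcases T.eq_empty_or_nonempty with rfl | ⟨t, ht⟩
  · left
    intro i
    convert hzH i (by simp) using 1
    funext k
    by_cases hk : k = i
    · subst hk
      rw [Pi.single_eq_same, hz1 k (by simp)]
    · rw [Pi.single_eq_of_ne hk, hz0 i (by simp) k (by simp) hk]
  · right
    refine ⟨t, fun j => if j = t then -1 else if j ∈ T then 0 else z j t, by simp, ?_, ?_⟩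
    · intro i
      dsimp only
      split_ifs with h1 h2
      · rw [h1, sub_self]
        exact neg_mem SetLike.GradedOne.one_mem
      · exact zero_mem _
      · exact hgr _ _ (hzH i h2) t
    · intro m y hy
      rw [← Finset.add_sum_erase _ _ (Finset.mem_univ t)]
      have hsub : Finset.univ \ T ⊆ Finset.univ.erase t := by
        intro j hj
        have hjT : j ∉ T := by simpa using hj
        simp only [Finset.mem_erase, Finset.mem_univ, and_true]
        rintro rfl
        exact hjT ht
      rw [← Finset.sum_subset hsub]
      beta_reduce
      rw [if_pos rfl, mul_neg, mul_one, hreduce m y hy t, neg_add_eq_zero]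
      · refine Finset.sum_congr rfl fun j hj => ?_
        have hjT : j ∉ T := by simpa using hj
        have hjt : j ≠ t := fun h => hjT (h ▸ ht)
        rw [if_neg hjt, if_neg hjT]
      · intro j hj hjT
        beta_reduce
        rw [if_neg (Finset.ne_of_mem_erase hj), if_pos (by simpa using hjT), mul_zero]

/-- The linear map scaling the component of degree `lam` by `ε δ lam`. -/
noncomputable def colorTwist (𝒜 : Γ → Submodule F A) [GradedAlgebra 𝒜] (ε : Γ → Γ → F) (δ : Γ) :
    Module.End F A :=
  DirectSum.toModule F Γ A (fun lam => ε δ lam • (𝒜 lam).subtype) ∘ₗ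
    (DirectSum.decomposeLinearEquiv 𝒜).toLinearMap

theorem colorTwist_of_mem (𝒜 : Γ → Submodule F A) [GradedAlgebra 𝒜] (ε : Γ → Γ → F) (δ : Γ)
    {lam : Γ} {x : A} (hx : x ∈ 𝒜 lam) : colorTwist 𝒜 ε δ x = ε δ lam • x := by
  simp only [colorTwist, LinearMap.comp_apply, LinearEquiv.coe_coe,
    DirectSum.decomposeLinearEquiv_apply]
  rw [DirectSum.decompose_of_mem 𝒜 hx]
  erw [DirectSum.toModule_lof]
  simp

theorem end_ext_of_homogeneous (𝒜 : Γ → Submodule F A) [GradedAlgebra 𝒜] {f g : Module.End F A}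
    (h : ∀ lam, ∀ x ∈ 𝒜 lam, f x = g x) : f = g := by
  classical
  ext x
  rw [← DirectSum.sum_support_decompose 𝒜 x, map_sum, map_sum]
  exact Finset.sum_congr rfl fun lam _ => h lam _ (SetLike.coe_mem _)

theorem mulL_apply_apply (x y : A) : mulL F A x y = x * y := rfl

theorem mulL_mul (x y : A) : mulL F A (x * y) = mulL F A x * mulL F A y :=
  map_mul (Algebra.lmul F A) x y

namespace IsBichar

variable {ε : Γ → Γ → F}

theorem ne_zero (h : IsBichar ε) (lam mu : Γ) : ε lam mu ≠ 0 :=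
  left_ne_zero_of_mul_eq_one (h.1 lam mu)

theorem add_left (h : IsBichar ε) (lam mu nu : Γ) : ε (lam + mu) nu = ε lam nu * ε mu nu := by
  have h1 := h.1 (lam + mu) nu
  have h2 := h.1 lam nu
  have h3 := h.1 mu nu
  rw [h.2] at h1
  apply mul_right_cancel₀ (mul_ne_zero (h.ne_zero nu lam) (h.ne_zero nu mu))
  rw [h1, mul_mul_mul_comm, h2, h3, one_mul]

theorem zero_right (h : IsBichar ε) (lam : Γ) : ε lam 0 = 1 := by
  have := h.2 lam 0 0
  rw [add_zero] at this
  exact (mul_eq_left₀ (h.ne_zero lam 0)).1 this.symm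

end IsBichar

theorem IsColorDer.apply_mul {𝒜 : Γ → Submodule F A} [GradedAlgebra 𝒜] {ε : Γ → Γ → F} {δ : Γ}
    {f : Module.End F A} (hf : IsColorDer 𝒜 ε δ f) (x y : A) :
    f (x * y) = f x * y + colorTwist 𝒜 ε δ x * f y := by
  induction x using DirectSum.Decomposition.inductionOn 𝒜 with
  | zero => simp
  | homogeneous a => rw [hf.2 _ _ a.2, colorTwist_of_mem 𝒜 ε δ a.2, smul_mul_assoc]
  | add a b ha hb =>
    rw [add_mul, map_add, ha, hb, map_add, map_add, add_mul, add_mul]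
    abel

theorem colorTwist_mul {𝒜 : Γ → Submodule F A} [GradedAlgebra 𝒜] {ε : Γ → Γ → F}
    (hbich : IsBichar ε) (δ : Γ) (x y : A) :
    colorTwist 𝒜 ε δ (x * y) = colorTwist 𝒜 ε δ x * colorTwist 𝒜 ε δ y := by
  induction x using DirectSum.Decomposition.inductionOn 𝒜 with
  | zero => simp
  | @homogeneous lam a =>
    induction y using DirectSum.Decomposition.inductionOn 𝒜 with
    | zero => simp
    | @homogeneous mu b =>
      rw [colorTwist_of_mem 𝒜 ε δ a.2, colorTwist_of_mem 𝒜 ε δ b.2,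
        colorTwist_of_mem 𝒜 ε δ (SetLike.mul_mem_graded a.2 b.2), hbich.2, smul_mul_smul_comm]
    | add b c hb hc => rw [mul_add, map_add, hb, hc, map_add, mul_add]
  | add b c hb hc => rw [add_mul, map_add, hb, hc, map_add, add_mul]

theorem IsHomogMap.colorTwist_mul {𝒜 : Γ → Submodule F A} [GradedAlgebra 𝒜] {ε : Γ → Γ → F}
    (hbich : IsBichar ε) {γ : Γ} {h : Module.End F A} (hh : IsHomogMap 𝒜 γ h) (δ : Γ) :
    colorTwist 𝒜 ε δ * h = (ε δ γ • h) * colorTwist 𝒜 ε δ := by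
  refine end_ext_of_homogeneous 𝒜 fun lam x hx => ?_
  rw [Module.End.mul_apply, Module.End.mul_apply, colorTwist_of_mem 𝒜 ε δ hx,
    colorTwist_of_mem 𝒜 ε δ (hh lam x hx), hbich.2, LinearMap.smul_apply, map_smul, smul_smul,
    mul_comm]

/-- Homogeneous elements of `D` color-commute with the homogeneous elements of `F₁[D]`. -/
theorem colorComm_of_mem_F1D {𝒜 : Γ → Submodule F A} [GradedAlgebra 𝒜] {ε : Γ → Γ → F}
    {D : Submodule F (Module.End F A)} (hbich : IsBichar ε) (hDgr : DGraded 𝒜 ε D)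
    (hDcc : DColorComm 𝒜 ε D) {f : Module.End F A} (hf : f ∈ D) {δ : Γ}
    (hfδ : IsColorDer 𝒜 ε δ f) {h : Module.End F A} (hh : h ∈ F1D D) {γ : Γ}
    (hγ : IsHomogMap 𝒜 γ h) : f * h = ε δ γ • (h * f) := by
  have key : ∃ h', f * h = h' * f ∧ colorTwist 𝒜 ε δ * h = h' * colorTwist 𝒜 ε δ := by
    clear hγ
    induction hh using Algebra.adjoin_induction with
    | mem h hh =>
      rcases hh with ⟨u, hu, rfl⟩ | hh
      · refine ⟨mulL F A (colorTwist 𝒜 ε δ u), ?_, ?_⟩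
        · ext b
          simp only [Module.End.mul_apply, mulL_apply_apply]
          rw [hfδ.apply_mul, hu f hf, zero_mul, zero_add]
        · ext b
          simp only [Module.End.mul_apply, mulL_apply_apply]
          exact colorTwist_mul hbich δ u b
      · rw [SetLike.mem_coe, hDgr] at hh
        induction hh using Submodule.span_induction with
        | mem h hh =>
          obtain ⟨hh, δ', hhδ⟩ := hh
          refine ⟨ε δ δ' • h, ?_, hhδ.1.colorTwist_mul hbich δ⟩
          rw [hDcc δ δ' f h hf hh hfδ hhδ, smul_mul_assoc]
        | zero => exact ⟨0, by simp, by simp⟩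
        | add x y _ _ hx hy =>
          obtain ⟨x', hx1, hx2⟩ := hx
          obtain ⟨y', hy1, hy2⟩ := hy
          exact ⟨x' + y', by rw [mul_add, hx1, hy1, add_mul], by rw [mul_add, hx2, hy2, add_mul]⟩
        | smul c x _ hx =>
          obtain ⟨x', hx1, hx2⟩ := hx
          exact ⟨c • x', by rw [mul_smul_comm, hx1, smul_mul_assoc],
            by rw [mul_smul_comm, hx2, smul_mul_assoc]⟩
    | algebraMap r =>
      exact ⟨algebraMap F _ r, (Algebra.commutes r f).symm, (Algebra.commutes r _).symm⟩
    | add x y _ _ hx hy =>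
      obtain ⟨x', hx1, hx2⟩ := hx
      obtain ⟨y', hy1, hy2⟩ := hy
      exact ⟨x' + y', by rw [mul_add, hx1, hy1, add_mul], by rw [mul_add, hx2, hy2, add_mul]⟩
    | mul x y _ _ hx hy =>
      obtain ⟨x', hx1, hx2⟩ := hx
      obtain ⟨y', hy1, hy2⟩ := hy
      exact ⟨x' * y', by rw [← mul_assoc, hx1, mul_assoc, hy1, mul_assoc],
        by rw [← mul_assoc, hx2, mul_assoc, hy2, mul_assoc]⟩
  obtain ⟨h', h1, h2⟩ := key
  have h3 : h' = ε δ γ • h := by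
    refine end_ext_of_homogeneous 𝒜 fun lam x hx => ?_
    have h4 := congrArg (fun φ : Module.End F A => φ x) (h2.symm.trans (hγ.colorTwist_mul hbich δ))
    simp only [Module.End.mul_apply] at h4
    rw [colorTwist_of_mem 𝒜 ε δ hx, map_smul, map_smul] at h4
    exact smul_right_injective _ (hbich.ne_zero δ lam) h4
  rw [h1, h3, smul_mul_assoc]

theorem IsHomogMap.mul {𝒜 : Γ → Submodule F A} {γ γ' : Γ} {f g : Module.End F A}
    (hf : IsHomogMap 𝒜 γ f) (hg : IsHomogMap 𝒜 γ' g) : IsHomogMap 𝒜 (γ + γ') (f * g) := by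
  intro lam a ha
  have := hf _ _ (hg lam a ha)
  rwa [add_assoc, add_comm γ' γ] at this

theorem isHomogMap_one (𝒜 : Γ → Submodule F A) : IsHomogMap 𝒜 0 (1 : Module.End F A) := by
  intro lam a ha
  rwa [add_zero]

theorem IsHomogMap.pow {𝒜 : Γ → Submodule F A} {γ : Γ} {f : Module.End F A}
    (hf : IsHomogMap 𝒜 γ f) (k : ℕ) : IsHomogMap 𝒜 (k • γ) (f ^ k) := by
  induction k with
  | zero => simpa using isHomogMap_one 𝒜
  | succ k ih => rw [succ_nsmul, pow_succ]; exact ih.mul hf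

theorem isHomogMap_mulL (𝒜 : Γ → Submodule F A) [GradedAlgebra 𝒜] {lam : Γ} {x : A}
    (hx : x ∈ 𝒜 lam) : IsHomogMap 𝒜 lam (mulL F A x) := by
  intro mu a ha
  rw [add_comm]
  exact SetLike.mul_mem_graded hx ha

theorem isHomogMap_dpow {𝒜 : Γ → Submodule F A} {d : I → Module.End F A} {δd : I → Γ}
    (hd : ∀ i, IsHomogMap 𝒜 (δd i) (d i)) (α : I →₀ ℕ) :
    IsHomogMap 𝒜 (degJ δd α) (dpow d α) := by
  have hlist : ∀ l : List I, IsHomogMap 𝒜 (l.map fun i => α i • δd i).sum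
      (l.map fun i => d i ^ α i).prod := by
    intro l
    induction l with
    | nil => exact isHomogMap_one 𝒜
    | cons i l ih =>
      rw [List.map_cons, List.map_cons, List.sum_cons, List.prod_cons]
      exact ((hd i).pow _).mul ih
  have hsum : degJ δd α = ((α.support.sort (· ≤ ·)).map fun i => α i • δd i).sum := by
    rw [degJ, Finsupp.sum, ← Multiset.sum_coe, ← Multiset.map_coe, Finset.sort_eq]
    rfl
  rw [hsum]
  exact hlist _

theorem dpow_mem {d : I → Module.End F A} {S : Subalgebra F (Module.End F A)}
    (hd : ∀ i, d i ∈ S) (α : I →₀ ℕ) : dpow d α ∈ S := by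
  refine S.list_prod_mem fun x hx => ?_
  obtain ⟨i, -, rfl⟩ := List.mem_map.1 hx
  exact pow_mem (hd i) _

theorem mulL_mem_AD (D : Submodule F (Module.End F A)) (x : A) : mulL F A x ∈ AD D :=
  Algebra.subset_adjoin (Or.inl ⟨x, rfl⟩)

theorem F1D_le_AD (D : Submodule F (Module.End F A)) : F1D D ≤ AD D := by
  refine Algebra.adjoin_mono (Set.union_subset_union_left _ ?_)
  rintro _ ⟨x, -, rfl⟩
  exact ⟨x, rfl⟩

/-- Homogeneous vectors `y` of total degree `m` with `∑ x yᵢ qᵢ ∈ W` for all `x`. -/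
def coeffSub (𝒜 : Γ → Submodule F A) {ι : Type} [Fintype ι] (g : ι → Γ)
    (q : ι → Module.End F A) (W : Submodule F (Module.End F A)) (m : Γ) :
    Submodule F (ι → A) where
  carrier := {y | (∀ i, y i ∈ 𝒜 (m - g i)) ∧ ∀ x, ∑ i, mulL F A (x * y i) * q i ∈ W}
  add_mem' := by
    rintro y z ⟨hy, hy'⟩ ⟨hz, hz'⟩
    refine ⟨fun i => add_mem (hy i) (hz i), fun x => ?_⟩
    simp only [Pi.add_apply, mul_add, map_add, add_mul, Finset.sum_add_distrib]
    exact add_mem (hy' x) (hz' x)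
  zero_mem' := ⟨fun i => zero_mem _, fun x => by simp⟩
  smul_mem' := by
    rintro c y ⟨hy, hy'⟩
    refine ⟨fun i => Submodule.smul_mem _ c (hy i), fun x => ?_⟩
    simp only [Pi.smul_apply, mul_smul_comm, map_smul, smul_mul_assoc, ← Finset.smul_sum]
    exact Submodule.smul_mem _ c (hy' x)

/-- To bound all `∑ x yᵢ qᵢ` it suffices to consider homogeneous `x`. -/
theorem sum_mulL_mem_of_homogeneous (𝒜 : Γ → Submodule F A) [GradedAlgebra 𝒜] {ι : Type}
    [Fintype ι] {q : ι → Module.End F A} {W : Submodule F (Module.End F A)} {y : ι → A}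
    (h : ∀ lam, ∀ x ∈ 𝒜 lam, ∑ i, mulL F A (x * y i) * q i ∈ W) (x : A) :
    ∑ i, mulL F A (x * y i) * q i ∈ W := by
  induction x using DirectSum.Decomposition.inductionOn 𝒜 with
  | zero => simp
  | homogeneous a => exact h _ _ a.2
  | add a b ha hb =>
    simp only [map_add, add_mul, Finset.sum_add_distrib]
    exact add_mem ha hb

theorem coeffSub_map_mem {𝒜 : Γ → Submodule F A} [GradedAlgebra 𝒜] {ε : Γ → Γ → F}
    {D : Submodule F (Module.End F A)} (hbich : IsBichar ε) (hDgr : DGraded 𝒜 ε D)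
    (hDcc : DColorComm 𝒜 ε D) {ι : Type} [Fintype ι] {g : ι → Γ} {q : ι → Module.End F A}
    (hq : ∀ i, q i ∈ F1D D) (hqg : ∀ i, IsHomogMap 𝒜 (g i) (q i))
    {f : Module.End F A} (hf : f ∈ D) {δ : Γ} (hfδ : IsColorDer 𝒜 ε δ f) {m : Γ} {y : ι → A}
    (hy : y ∈ coeffSub 𝒜 g q (Wsub 𝒜 ε D) m) :
    (fun i => f (y i)) ∈ coeffSub 𝒜 g q (Wsub 𝒜 ε D) (m + δ) := by
  refine ⟨fun i => ?_, sum_mulL_mem_of_homogeneous 𝒜 fun lam x hx => ?_⟩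
  · have := hfδ.1 _ _ (hy.1 i)
    rwa [sub_add_eq_add_sub] at this
  set Z : Module.End F A := ∑ i, mulL F A (x * y i) * q i with hZ
  have hterm : ∀ i, IsHomogMap 𝒜 (lam + m) (mulL F A (x * y i) * q i) := by
    intro i
    have := (isHomogMap_mulL 𝒜 (SetLike.mul_mem_graded hx (hy.1 i))).mul (hqg i)
    rwa [add_assoc, sub_add_cancel] at this
  have hZhom : IsHomogMap 𝒜 (lam + m) Z := by
    intro mu b hb
    rw [hZ, LinearMap.sum_apply]
    exact Submodule.sum_mem _ fun i _ => hterm i mu b hb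
  have hZAD : Z ∈ AD D :=
    Subalgebra.sum_mem _ fun i _ => mul_mem (mulL_mem_AD D _) (F1D_le_AD D (hq i))
  have hbr : f * Z - ε δ (lam + m) • (Z * f) ∈ Wsub 𝒜 ε D :=
    Submodule.subset_span ⟨δ, lam + m, f, Z, Algebra.subset_adjoin (Or.inr hf), hZAD, hfδ.1,
      hZhom, rfl⟩
  have hcomp : ∀ i, f * (mulL F A (x * y i) * q i) -
      ε δ (lam + m) • (mulL F A (x * y i) * q i * f) = mulL F A (f (x * y i)) * q i := by
    intro i
    have hxy := SetLike.mul_mem_graded hx (hy.1 i)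
    have h1 : f * mulL F A (x * y i) =
        mulL F A (f (x * y i)) + ε δ (lam + (m - g i)) • (mulL F A (x * y i) * f) := by
      ext b
      exact hfδ.2 _ _ hxy b
    rw [← mul_assoc, h1, add_mul, smul_mul_assoc, mul_assoc _ f,
      colorComm_of_mem_F1D hbich hDgr hDcc hf hfδ (hq i) (hqg i), mul_smul_comm, smul_smul,
      ← hbich.2, add_assoc, sub_add_cancel, ← mul_assoc, add_sub_cancel_right]
  have hbr' : f * Z - ε δ (lam + m) • (Z * f) = ∑ i, mulL F A (f (x * y i)) * q i := by
    rw [hZ, Finset.mul_sum, Finset.sum_mul, Finset.smul_sum, ← Finset.sum_sub_distrib]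
    exact Finset.sum_congr rfl fun i _ => hcomp i
  have hleib : ∑ i, mulL F A (f (x * y i)) * q i =
      ∑ i, mulL F A (f x * y i) * q i + ε δ lam • ∑ i, mulL F A (x * f (y i)) * q i := by
    rw [Finset.smul_sum, ← Finset.sum_add_distrib]
    refine Finset.sum_congr rfl fun i _ => ?_
    rw [hfδ.2 lam x hx, map_add, map_smul, add_mul, smul_mul_assoc]
  rw [hbr', hleib] at hbr
  exact (Submodule.smul_mem_iff _ (hbich.ne_zero δ lam)).1
    ((Submodule.add_mem_iff_right _ (hy.2 (f x))).1 hbr)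

theorem degJ_sub_single (δd : I → Γ) {β : I →₀ ℕ} {j : I} (hj : β j ≠ 0) :
    degJ δd (β - Finsupp.single j 1) = degJ δd β - δd j := by
  have hle : Finsupp.single j 1 ≤ β := by
    rw [Finsupp.single_le_iff]
    exact Nat.one_le_iff_ne_zero.2 hj
  rw [eq_sub_iff_add_eq]
  conv_rhs => rw [← tsub_add_cancel_of_le hle]
  unfold degJ
  rw [Finsupp.sum_add_index' (by simp) (by intro i k l; exact add_nsmul _ _ _)]
  simp

theorem stmt_10
    (𝒜 : Γ → Submodule F A) [GradedAlgebra 𝒜] (ε : Γ → Γ → F)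
    (D : Submodule F (Module.End F A))
    (hchar : (2 : F) ≠ 0)
    (hbich : IsBichar ε)
    (hcomm : IsColorComm 𝒜 ε)
    (hDder : D ≤ DerE 𝒜 ε)
    (hDgr : DGraded 𝒜 ε D)
    (hDcc : DColorComm 𝒜 ε D)
    (hDne : D ≠ ⊥)
    (hsimple : GradedDSimple 𝒜 D)
    (d : I → Module.End F A) (δd : I → Γ)
    (hdD : ∀ i, d i ∈ DScr 𝒜 ε D)
    (hdhom : ∀ i, IsColorDer 𝒜 ε (δd i) (d i))
    (hdspan : ∀ f ∈ DScr 𝒜 ε D, ∃ (s : Finset I) (c : I → A),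
      (∀ i, c i ∈ F1 D) ∧ f = ∑ i ∈ s, mulL F A (c i) * d i)
    (hdind : ∀ (s : Finset I) (c : I → A), (∀ i, c i ∈ F1 D) →
      (∑ i ∈ s, mulL F A (c i) * d i) = 0 → ∀ i ∈ s, c i = 0)
    (n : ℕ) (e : Fin n → I) (he : Function.Injective e)
    (β : I →₀ ℕ) (hβJ : inJ ε δd β) (hsupp : (β.support : Set I) = Set.range e)
    (pd : Fin n → Module.End F A) (δp : Fin n → Γ)
    (hpd : ∀ i, IsColorDer 𝒜 ε (δp i) (pd i))
    (hAind : ∀ c : Fin n → A, (∑ i, mulL F A (c i) * pd i) = 0 → ∀ i, c i = 0)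
    (hdeg : ∀ i j, δp i - δd (e i) = δp j - δd (e j))
    (a : Fin n → F) (ha : ∀ i, a i ≠ 0)
    (h313 : ∀ (x b : A) (lam mu : Γ), x ∈ 𝒜 lam → b ∈ 𝒜 mu →
      mulL F A x * (∑ i, (a i * ε (degJ δd (β - Finsupp.single (e i) 1)) mu) •
        (mulL F A (pd i b) * dpow d (β - Finsupp.single (e i) 1))) ∈ Wsub 𝒜 ε D) :
    ∀ (i : Fin n) (c : A),
      mulL F A c * dpow d (β - Finsupp.single (e i) 1) ∈ Wsub 𝒜 ε D := by
  intro i₀ c₀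
  set g : Fin n → Γ := fun i => degJ δd (β - Finsupp.single (e i) 1) with hg
  set q : Fin n → Module.End F A := fun i => dpow d (β - Finsupp.single (e i) 1) with hq
  have hgi : ∀ i, g i = degJ δd β - δd (e i) := fun i => degJ_sub_single δd (by
    have : e i ∈ (β.support : Set I) := hsupp ▸ Set.mem_range_self i
    simpa using this)
  have hκ : ∀ i, δp i + g i = δp i₀ + g i₀ := by
    intro i
    rw [hgi, hgi, add_sub_left_comm, add_sub_left_comm (δp i₀), hdeg i i₀]
  have hqF : ∀ i, q i ∈ F1D D := fun i => dpow_mem (fun j => (hdD j).1) _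
  have hqg : ∀ i, IsHomogMap 𝒜 (g i) (q i) := fun i => isHomogMap_dpow (fun j => (hdhom j).1) _
  have hv : ∀ mu, ∀ b ∈ 𝒜 mu, (fun i => (a i * ε (g i) mu) • pd i b) ∈
      coeffSub 𝒜 g q (Wsub 𝒜 ε D) (mu + (δp i₀ + g i₀)) := by
    intro mu b hb
    refine ⟨fun i => Submodule.smul_mem _ _ ?_, sum_mulL_mem_of_homogeneous 𝒜 fun lam x hx => ?_⟩
    · rw [← hκ i, ← add_assoc, add_sub_cancel_right]
      exact (hpd i).1 mu b hb
    · have := h313 x b lam mu hx hb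
      rw [Finset.mul_sum] at this
      convert this using 2 with i
      rw [mul_smul_comm, map_smul, smul_mul_assoc, mul_smul_comm, mulL_mul, mul_assoc]
  have hmul : ∀ ρ m, ∀ r ∈ 𝒜 ρ, ∀ y ∈ coeffSub 𝒜 g q (Wsub 𝒜 ε D) m,
      (fun i => r * y i) ∈ coeffSub 𝒜 g q (Wsub 𝒜 ε D) (ρ + m) := by
    intro ρ m r hr y hy
    refine ⟨fun i => ?_, fun x => ?_⟩
    · rw [add_sub_assoc]
      exact SetLike.mul_mem_graded hr (hy.1 i)
    · simpa only [mul_assoc] using hy.2 (x * r)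
  rcases single_mem_or_exists_annihilator 𝒜 ε D hDgr hsimple g
      (coeffSub 𝒜 g q (Wsub 𝒜 ε D)) (fun m y hy => hy.1) hmul
      (fun f hf δ hfδ m y hy => coeffSub_map_mem hbich hDgr hDcc hqF hqg hf hfδ hy)
    with hall | ⟨t, c, hct, hcdeg, hcann⟩
  · have := (hall i₀).2 c₀
    rw [Finset.sum_eq_single i₀] at this
    · simpa using this
    · intro j _ hj
      rw [Pi.single_eq_of_ne hj]
      simp
    · simp
  · have hzero : ∑ i, mulL F A ((a i * ε (δp i) (g i - g t)) • c i) * pd i = 0 := by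
      refine end_ext_of_homogeneous 𝒜 fun mu b hb => ?_
      have h0 := hcann _ _ (hv mu b hb)
      have hsum : ∑ i, ((a i * ε (g i) mu) • pd i b) * c i = ε mu (-g t) •
          ∑ i, mulL F A ((a i * ε (δp i) (g i - g t)) • c i) (pd i b) := by
        rw [Finset.smul_sum]
        refine Finset.sum_congr rfl fun i _ => ?_
        rw [mulL_apply_apply, smul_mul_assoc, smul_mul_assoc,
          hcomm _ _ _ ((hpd i).1 mu b hb) _ (hcdeg i), smul_smul, smul_smul, hbich.add_left]
        congr 1
        rw [sub_eq_add_neg, hbich.2 mu]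
        linear_combination (a i * ε mu (-g t) * ε (δp i) (g i + -g t)) * hbich.1 (g i) mu
      rw [hsum, smul_eq_zero_iff_right (hbich.ne_zero _ _)] at h0
      rw [LinearMap.sum_apply, LinearMap.zero_apply]
      exact h0
    have ht := hAind _ hzero t
    rw [sub_self, hbich.zero_right, mul_one, hct, smul_eq_zero_iff_right (ha t), neg_eq_zero] at ht
    have hsub : Subsingleton A := subsingleton_of_zero_eq_one ht.symm
    rw [Subsingleton.elim c₀ 0, map_zero, zero_mul]
    exact zero_mem _
end

section
/- Suppose A is Γ-graded D-simple. Then every nonzero homogeneous element of F₁ = A^D is invertible in A, and (F₁)₋ = 0, i.e. F₁ contains no nonzero homogeneous element whose degree λ satisfies ε(λ,λ) = −1. -/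
variable (F : Type) [Field F] (Γ : Type) [AddCommGroup Γ] [DecidableEq Γ]
  (A : Type) [Ring A] [Algebra F A]

variable {F Γ A}

variable {I : Type} [LinearOrder I]

/-- In an `ε`-commutative algebra, left multiples of a homogeneous element are right multiples. -/
theorem IsColorComm.exists_mul_eq_mul {𝒜 : Γ → Submodule F A} [GradedAlgebra 𝒜] {ε : Γ → Γ → F}
    (hcomm : IsColorComm 𝒜 ε) {u : A} {lam : Γ} (hu : u ∈ 𝒜 lam) (a : A) :
    ∃ b, a * u = u * b := by
  induction a using DirectSum.Decomposition.inductionOn 𝒜 with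
  | zero => exact ⟨0, by simp⟩
  | @homogeneous mu m =>
    exact ⟨ε mu lam • (m : A), by rw [hcomm mu lam m m.2 u hu, mul_smul_comm]⟩
  | add a a' ha ha' =>
    obtain ⟨b, hb⟩ := ha
    obtain ⟨b', hb'⟩ := ha'
    exact ⟨b + b', by rw [add_mul, mul_add, hb, hb']⟩

/-- A color-derivation killing `u` commutes with right multiplication by `u`. -/
theorem IsColorDer.map_mul_of_map_eq_zero {𝒜 : Γ → Submodule F A} [GradedAlgebra 𝒜]
    {ε : Γ → Γ → F} {δ : Γ} {f : Module.End F A} (hf : IsColorDer 𝒜 ε δ f) {u : A}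
    (hu : f u = 0) (a : A) : f (a * u) = f a * u := by
  induction a using DirectSum.Decomposition.inductionOn 𝒜 with
  | zero => simp
  | @homogeneous mu m => rw [hf.2 mu m m.2 u, hu, mul_zero, smul_zero, add_zero]
  | add a a' ha ha' => rw [add_mul, map_add, map_add, add_mul, ha, ha']

/-- Elements of a graded `D` commute with right multiplication by elements of `F₁ = A^D`. -/
theorem DGraded.map_mul_of_mem_F1 {𝒜 : Γ → Submodule F A} [GradedAlgebra 𝒜] {ε : Γ → Γ → F}
    {D : Submodule F (Module.End F A)} (hDgr : DGraded 𝒜 ε D) {f : Module.End F A} (hf : f ∈ D)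
    {u : A} (hu : u ∈ F1 D) (a : A) : f (a * u) = f a * u := by
  rw [hDgr] at hf
  induction hf using Submodule.span_induction with
  | mem g hg =>
    obtain ⟨hgD, δ, hδ⟩ := hg
    exact hδ.map_mul_of_map_eq_zero (hu g hgD) a
  | zero => simp
  | add g g' _ _ hg hg' => rw [LinearMap.add_apply, LinearMap.add_apply, add_mul, hg, hg']
  | smul c g _ hg => rw [LinearMap.smul_apply, LinearMap.smul_apply, smul_mul_assoc, hg]

theorem stmt_17
    (𝒜 : Γ → Submodule F A) [GradedAlgebra 𝒜] (ε : Γ → Γ → F)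
    (D : Submodule F (Module.End F A))
    (hchar : (2 : F) ≠ 0)
    (hbich : IsBichar ε)
    (hcomm : IsColorComm 𝒜 ε)
    (hDder : D ≤ DerE 𝒜 ε)
    (hDgr : DGraded 𝒜 ε D)
    (hDcc : DColorComm 𝒜 ε D)
    (hDne : D ≠ ⊥)
    (hsimple : GradedDSimple 𝒜 D)
    :
    ∀ (u : A) (lam : Γ), u ∈ F1 D → u ∈ 𝒜 lam → u ≠ 0 →
      IsUnit u ∧ ε lam lam ≠ -1 := by
  intro u lam hu hlam hne
  have hI : Ideal.span {u} = ⊤ := by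
    refine (hsimple (Ideal.span {u}) ?_ ?_).resolve_left ?_
    · refine Ideal.homogeneous_span 𝒜 _ ?_
      rintro x rfl
      exact ⟨lam, hlam⟩
    · intro f hf x hx
      obtain ⟨a, rfl⟩ := Ideal.mem_span_singleton'.mp hx
      rw [hDgr.map_mul_of_mem_F1 hf hu a]
      exact Ideal.mem_span_singleton'.mpr ⟨f a, rfl⟩
    · rwa [Ideal.span_singleton_eq_bot]
  obtain ⟨v, hv⟩ := Ideal.mem_span_singleton'.mp ((Ideal.eq_top_iff_one _).mp hI)
  obtain ⟨w, hw⟩ := hcomm.exists_mul_eq_mul hlam v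
  have hunit : IsUnit u :=
    isUnit_iff_exists_and_exists.mpr ⟨⟨w, hw.symm.trans hv⟩, ⟨v, hv⟩⟩
  refine ⟨hunit, fun hε => hne ?_⟩
  have hsq : (2 : F) • (u * u) = 0 := by
    have h := hcomm lam lam u hlam u hlam
    rw [hε, neg_one_smul] at h
    rw [two_smul]
    exact eq_neg_iff_add_eq_zero.mp h
  exact hunit.mul_right_eq_zero.mp ((smul_eq_zero.mp hsq).resolve_left hchar)
end
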